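/- Let k ≥ 2, v = 2k, and S = F_2[U] the polynomial ring over the field F_2 with two elements. Let A be the free S-module with basis {a, b, c, e, z_0} ∪ {w_r^s : 1 ≤ r ≤ v, s ∈ {1,2}}, with S-linear differential ∂ given by ∂a = b + c, ∂b = ∂c = U·e, ∂w_1^s = U·z_0 + w_2^s, ∂w_r^s = U·w_{r-1}^s + w_{r+1}^s for odd r with 3 ≤ r ≤ v-3, ∂w_{v-1}^s = U²·w_{v-2}^s + w_v^s, and ∂ = 0 on e, z_0, and w_r^s for even r. Then ∂ ∘ ∂ = 0 and the homology ker(∂)/range(∂) is isomorphic as an S-module to F_2[U] ⊕ F_2[U]/(U), where the free summand is generated by the class of z_0 and the torsion summand by the class of e. -/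

import Mathlib

/- The homology of the subcomplex A₀⁻ of the dual model complex C̄₁ is
F₂[U] ⊕ F₂[U]/(U), with free part generated by the class of z₀ and torsion part by the
class of e. -/

/-- `S2` is the polynomial ring `F₂[U]` (with `U = Polynomial.X`). -/
abbrev S2 : Type := Polynomial (ZMod 2)

/-- Basis `{a, b, c, e, z_0} ∪ {w_r^s : 1 ≤ r ≤ v, s ∈ {1,2}}` of the subcomplex `A₀⁻`
of the dual model complex `C̄₁`. -/
inductive AB (v : ℕ) : Type
  | a | b | c | e | z0 | w (s : Fin 2) (r : Fin v)
  deriving DecidableEq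

/-- The basis vector `w_r^{s+1}` for `1 ≤ r ≤ v`, extended by `0` outside that range. -/
noncomputable def wS (v : ℕ) (s : Fin 2) (r : ℕ) : AB v → S2 :=
  if h : 1 ≤ r ∧ r ≤ v then Pi.single (AB.w s ⟨r - 1, by omega⟩) 1 else 0

open Polynomial

instance AB.instFinite (v : ℕ) : Finite (AB v) := by
  refine Finite.of_surjective (α := Fin 5 ⊕ Fin 2 × Fin v)
    (Sum.elim ![AB.a, AB.b, AB.c, AB.e, AB.z0] fun p => AB.w p.1 p.2) ?_
  rintro (_ | _ | _ | _ | _ | ⟨s, r⟩)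
  · exact ⟨Sum.inl 0, rfl⟩
  · exact ⟨Sum.inl 1, rfl⟩
  · exact ⟨Sum.inl 2, rfl⟩
  · exact ⟨Sum.inl 3, rfl⟩
  · exact ⟨Sum.inl 4, rfl⟩
  · exact ⟨Sum.inr (s, r), rfl⟩

/-- The coordinate along `w_r^{s+1}`, extended by `0` outside `1 ≤ r ≤ v`. -/
noncomputable def wCoord (v : ℕ) (s : Fin 2) (r : ℕ) : (AB v → S2) →ₗ[S2] S2 :=
  if h : 1 ≤ r ∧ r ≤ v then LinearMap.proj (AB.w s ⟨r - 1, by omega⟩) else 0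

lemma single_w_eq_wS {v : ℕ} (s : Fin 2) (r : Fin v) :
    (Pi.single (AB.w s r) 1 : AB v → S2) = wS v s (r + 1) := by
  have := r.2
  simp [wS]

lemma apply_w_eq_wCoord {v : ℕ} (s : Fin 2) (r : Fin v) (x : AB v → S2) :
    x (AB.w s r) = wCoord v s (r + 1) x := by
  have := r.2
  simp [wCoord]

lemma wCoord_of_lt {v : ℕ} (s : Fin 2) {r : ℕ} (h : v < r) : wCoord v s r = 0 := by
  have : ¬ r ≤ v := by omega
  simp [wCoord, this]

lemma wCoord_single {v : ℕ} (s : Fin 2) (r : ℕ) (i : AB v) (hi : ∀ s r, i ≠ AB.w s r) :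
    wCoord v s r (Pi.single i 1) = 0 := by
  unfold wCoord
  split_ifs
  · exact Pi.single_eq_of_ne (hi _ _).symm _
  · rfl

lemma wCoord_wS {v : ℕ} (s t : Fin 2) (q r : ℕ) (hq : 1 ≤ q) (hqv : q ≤ v) :
    wCoord v s q (wS v t r) = if s = t ∧ q = r then 1 else 0 := by
  unfold wCoord wS
  rw [dif_pos ⟨hq, hqv⟩]
  by_cases hr : 1 ≤ r ∧ r ≤ v
  · rw [dif_pos hr, LinearMap.proj_apply, Pi.single_apply]
    have : (s = t ∧ q - 1 = r - 1) ↔ (s = t ∧ q = r) := by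
      constructor <;> rintro ⟨h, h'⟩ <;> exact ⟨h, by omega⟩
    simp [this]
  · rw [dif_neg hr, map_zero, if_neg]
    rintro ⟨-, rfl⟩
    exact hr ⟨hq, hqv⟩

lemma wS_apply_of_forall_ne {v : ℕ} (s : Fin 2) (r : ℕ) (i : AB v) (hi : ∀ s r, i ≠ AB.w s r) :
    wS v s r i = 0 := by
  unfold wS
  split_ifs
  · exact Pi.single_eq_of_ne (hi _ _) _
  · rfl

/-- Every basis index is one of the five exceptional ones, or some `w` of odd or even degree. -/
lemma AB.induction_single {k : ℕ} {P : AB (2 * k) → (AB (2 * k) → S2) → Prop}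
    (ha : P AB.a (Pi.single AB.a 1)) (hb : P AB.b (Pi.single AB.b 1))
    (hc : P AB.c (Pi.single AB.c 1)) (he : P AB.e (Pi.single AB.e 1))
    (hz : P AB.z0 (Pi.single AB.z0 1))
    (hodd : ∀ s i (h : i < k), P (AB.w s ⟨2 * i, by omega⟩) (wS (2 * k) s (2 * i + 1)))
    (heven : ∀ s i (h : i < k), P (AB.w s ⟨2 * i + 1, by omega⟩) (wS (2 * k) s (2 * (i + 1))))
    (j : AB (2 * k)) : P j (Pi.single j 1) := by
  rcases j with _ | _ | _ | _ | _ | ⟨s, r, hr⟩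
  · exact ha
  · exact hb
  · exact hc
  · exact he
  · exact hz
  · rw [single_w_eq_wS]
    obtain ⟨i, rfl | rfl⟩ := Nat.even_or_odd' r
    · exact hodd s i (by omega)
    · exact heven s i (by omega)

lemma linearMap_ext_AB {k : ℕ} {M : Type*} [AddCommMonoid M] [Module S2 M]
    {f g : (AB (2 * k) → S2) →ₗ[S2] M}
    (ha : f (Pi.single AB.a 1) = g (Pi.single AB.a 1))
    (hb : f (Pi.single AB.b 1) = g (Pi.single AB.b 1))
    (hc : f (Pi.single AB.c 1) = g (Pi.single AB.c 1))
    (he : f (Pi.single AB.e 1) = g (Pi.single AB.e 1))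
    (hz : f (Pi.single AB.z0 1) = g (Pi.single AB.z0 1))
    (hodd : ∀ s i, i < k → f (wS (2 * k) s (2 * i + 1)) = g (wS (2 * k) s (2 * i + 1)))
    (heven : ∀ s i, i < k → f (wS (2 * k) s (2 * (i + 1))) = g (wS (2 * k) s (2 * (i + 1)))) :
    f = g := by
  have := Fintype.ofFinite (AB (2 * k))
  refine LinearMap.pi_ext' fun j => LinearMap.ext_ring ?_
  exact AB.induction_single (P := fun _ x => f x = g x) ha hb hc he hz hodd heven j

lemma mem_of_forall_smul_mem {k : ℕ} {N : Submodule S2 (AB (2 * k) → S2)}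
    {x : AB (2 * k) → S2}
    (ha : x AB.a • Pi.single AB.a 1 ∈ N) (hb : x AB.b • Pi.single AB.b 1 ∈ N)
    (hc : x AB.c • Pi.single AB.c 1 ∈ N) (he : x AB.e • Pi.single AB.e 1 ∈ N)
    (hz : x AB.z0 • Pi.single AB.z0 1 ∈ N)
    (hodd : ∀ s i (h : i < k), x (AB.w s ⟨2 * i, by omega⟩) • wS (2 * k) s (2 * i + 1) ∈ N)
    (heven : ∀ s i (h : i < k),
      x (AB.w s ⟨2 * i + 1, by omega⟩) • wS (2 * k) s (2 * (i + 1)) ∈ N) :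
    x ∈ N := by
  have := Fintype.ofFinite (AB (2 * k))
  rw [pi_eq_sum_univ' x]
  exact N.sum_mem fun j _ =>
    AB.induction_single (P := fun j y => x j • y ∈ N) ha hb hc he hz hodd heven j

/-- The even generators of one staircase, starting with `z_0` in degree `0`. -/
noncomputable def evenGen (v : ℕ) (s : Fin 2) (i : ℕ) : AB v → S2 :=
  if i = 0 then Pi.single AB.z0 1 else wS v s (2 * i)

lemma evenGen_zero (v : ℕ) (s : Fin 2) : evenGen v s 0 = Pi.single AB.z0 1 := if_pos rfl

lemma evenGen_succ (v : ℕ) (s : Fin 2) (i : ℕ) : evenGen v s (i + 1) = wS v s (2 * (i + 1)) :=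
  if_neg i.succ_ne_zero

lemma wCoord_evenGen {v : ℕ} (s t : Fin 2) (i j : ℕ) (hi : 2 * (i + 1) ≤ v) :
    wCoord v s (2 * (i + 1)) (evenGen v t j) = if s = t ∧ i + 1 = j then 1 else 0 := by
  rcases j with _ | j
  · rw [evenGen_zero, wCoord_single _ _ _ (by simp)]
    simp
  · rw [evenGen_succ, wCoord_wS _ _ _ _ (by omega) hi]
    simp

lemma evenGen_apply_of_ne {v : ℕ} (s : Fin 2) (j : ℕ) (i : AB v) (hi : ∀ s r, i ≠ AB.w s r)
    (hz : i ≠ AB.z0) : evenGen v s j i = 0 := by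
  rcases j with _ | j
  · rw [evenGen_zero, Pi.single_eq_of_ne hz]
  · rw [evenGen_succ, wS_apply_of_forall_ne _ _ _ hi]

/-- The differential of `A₀⁻`, in uniform notation: the odd generator `w_{2i+1}` is sent to
`p i` times the even generator below it plus the even generator above it. -/
structure IsStaircaseDifferential (k : ℕ) (p : ℕ → S2)
    (d : (AB (2 * k) → S2) →ₗ[S2] (AB (2 * k) → S2)) : Prop where
  map_a : d (Pi.single AB.a 1) = Pi.single AB.b 1 + Pi.single AB.c 1
  map_b : d (Pi.single AB.b 1) = (X : S2) • (Pi.single AB.e 1 : AB (2 * k) → S2)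
  map_c : d (Pi.single AB.c 1) = (X : S2) • (Pi.single AB.e 1 : AB (2 * k) → S2)
  map_e : d (Pi.single AB.e 1) = 0
  map_odd : ∀ s i, i < k → d (wS (2 * k) s (2 * i + 1)) =
    p i • evenGen (2 * k) s i + evenGen (2 * k) s (i + 1)
  map_even : ∀ s i, i ≤ k → d (evenGen (2 * k) s i) = 0

namespace IsStaircaseDifferential

variable {k : ℕ} {p : ℕ → S2} {d : (AB (2 * k) → S2) →ₗ[S2] (AB (2 * k) → S2)}

lemma map_z0 (hd : IsStaircaseDifferential k p d) : d (Pi.single AB.z0 1) = 0 := by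
  rw [← evenGen_zero _ 0, hd.map_even _ _ k.zero_le]

lemma map_w_even (hd : IsStaircaseDifferential k p d) (s : Fin 2) {i : ℕ} (hi : i < k) :
    d (wS (2 * k) s (2 * (i + 1))) = 0 := by
  rw [← evenGen_succ, hd.map_even _ _ hi]

lemma comp_self (hd : IsStaircaseDifferential k p d) : d ∘ₗ d = 0 := by
  apply linearMap_ext_AB
  · simp only [LinearMap.comp_apply, hd.map_a, map_add, hd.map_b, hd.map_c, CharTwo.add_self_eq_zero,
      LinearMap.zero_apply, ← add_smul, zero_smul]
  · simp [hd.map_b, hd.map_e]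
  · simp [hd.map_c, hd.map_e]
  · simp [hd.map_e]
  · simp [hd.map_z0]
  · intro s i hi
    simp [hd.map_odd s i hi, hd.map_even s i hi.le, hd.map_even s (i + 1) hi]
  · intro s i hi
    simp [hd.map_w_even s hi]

lemma apply_b (hd : IsStaircaseDifferential k p d) (x : AB (2 * k) → S2) :
    d x AB.b = x AB.a := by
  refine LinearMap.congr_fun (f := LinearMap.proj AB.b ∘ₗ d) (g := LinearMap.proj AB.a) ?_ x
  apply linearMap_ext_AB
  · simp [hd.map_a]
  · simp [hd.map_b]
  · simp [hd.map_c]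
  · simp [hd.map_e]
  · simp [hd.map_z0]
  · intro s i hi
    simp [hd.map_odd s i hi, evenGen_apply_of_ne, wS_apply_of_forall_ne]
  · intro s i hi
    simp [hd.map_w_even s hi, wS_apply_of_forall_ne]

lemma apply_e (hd : IsStaircaseDifferential k p d) (x : AB (2 * k) → S2) :
    d x AB.e = X * (x AB.b + x AB.c) := by
  refine LinearMap.congr_fun (f := LinearMap.proj AB.e ∘ₗ d)
    (g := (X : S2) • ((LinearMap.proj AB.b : (AB (2 * k) → S2) →ₗ[S2] S2) +
      LinearMap.proj AB.c)) ?_ x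
  apply linearMap_ext_AB
  · simp [hd.map_a]
  · simp [hd.map_b]
  · simp [hd.map_c]
  · simp [hd.map_e]
  · simp [hd.map_z0]
  · intro s i hi
    simp [hd.map_odd s i hi, evenGen_apply_of_ne, wS_apply_of_forall_ne]
  · intro s i hi
    simp [hd.map_w_even s hi, wS_apply_of_forall_ne]

lemma wCoord_even_apply (hd : IsStaircaseDifferential k p d) (s : Fin 2) {i : ℕ} (hi : i < k)
    (x : AB (2 * k) → S2) :
    wCoord (2 * k) s (2 * (i + 1)) (d x) =
      wCoord (2 * k) s (2 * i + 1) x + p (i + 1) * wCoord (2 * k) s (2 * (i + 1) + 1) x := by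
  refine LinearMap.congr_fun (f := wCoord (2 * k) s (2 * (i + 1)) ∘ₗ d)
    (g := wCoord (2 * k) s (2 * i + 1) + p (i + 1) • wCoord (2 * k) s (2 * (i + 1) + 1)) ?_ x
  apply linearMap_ext_AB
  · simp [hd.map_a, wCoord_single]
  · simp [hd.map_b, wCoord_single]
  · simp [hd.map_c, wCoord_single]
  · simp [hd.map_e, wCoord_single]
  · simp [hd.map_z0, wCoord_single]
  · intro t j hj
    simp only [LinearMap.comp_apply, LinearMap.add_apply, LinearMap.smul_apply, smul_eq_mul,
      hd.map_odd t j hj, map_add, map_smul]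
    rw [wCoord_evenGen _ _ _ _ (by omega), wCoord_evenGen _ _ _ _ (by omega),
      wCoord_wS _ _ (2 * i + 1) _ (by omega) (by omega)]
    by_cases h : i + 1 < k
    · rw [wCoord_wS _ _ _ _ (by omega) (by omega)]
      grind
    · rw [wCoord_of_lt _ (by omega), LinearMap.zero_apply]
      grind
  · intro t j hj
    simp only [LinearMap.comp_apply, LinearMap.add_apply, LinearMap.smul_apply, smul_eq_mul,
      hd.map_w_even t hj, map_zero]
    rw [wCoord_wS _ _ (2 * i + 1) _ (by omega) (by omega)]
    by_cases h : i + 1 < k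
    · rw [wCoord_wS _ _ _ _ (by omega) (by omega)]
      grind
    · rw [wCoord_of_lt _ (by omega), LinearMap.zero_apply]
      grind

/-- The matrix of `d` from odd to even generators is unitriangular, so `d x` determines the odd
coordinates of `x`. -/
lemma wCoord_odd_eq_zero (hd : IsStaircaseDifferential k p d) {x : AB (2 * k) → S2}
    (hx : ∀ s i, i < k → wCoord (2 * k) s (2 * (i + 1)) (d x) = 0) (s : Fin 2) (i : ℕ) :
    wCoord (2 * k) s (2 * i + 1) x = 0 := by
  induction h : k - i generalizing i with
  | zero => rw [wCoord_of_lt _ (by omega), LinearMap.zero_apply]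
  | succ n ih =>
    have hi : i < k := by omega
    have := hd.wCoord_even_apply s hi x
    rw [hx s i hi, ih (i + 1) (by omega), mul_zero, add_zero] at this
    exact this.symm

lemma apply_z0 (hd : IsStaircaseDifferential k p d) {x : AB (2 * k) → S2}
    (hx : ∀ s i, wCoord (2 * k) s (2 * i + 1) x = 0) : d x AB.z0 = 0 := by
  have h0 : d x AB.z0 = p 0 * ∑ s, wCoord (2 * k) s (2 * 0 + 1) x := by
    refine (LinearMap.congr_fun (f := LinearMap.proj AB.z0 ∘ₗ d)
      (g := p 0 • ∑ s, wCoord (2 * k) s (2 * 0 + 1)) ?_ x).trans (by simp [mul_add])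
    apply linearMap_ext_AB
    · simp [hd.map_a, wCoord_single]
    · simp [hd.map_b, wCoord_single]
    · simp [hd.map_c, wCoord_single]
    · simp [hd.map_e, wCoord_single]
    · simp [hd.map_z0, wCoord_single]
    · intro t j hj
      have hsum : (∑ s, wCoord (2 * k) s (2 * 0 + 1)) (wS (2 * k) t (2 * j + 1)) =
          if j = 0 then 1 else 0 := by
        rw [LinearMap.sum_apply,
          Finset.sum_congr rfl fun s _ => wCoord_wS s t _ _ (by omega) (by omega)]
        rcases j with _ | j <;> simp
      rw [LinearMap.smul_apply, hsum, LinearMap.comp_apply, hd.map_odd t j hj, evenGen_succ]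
      rcases j with _ | j
      · simp [evenGen_zero, wS_apply_of_forall_ne]
      · simp [evenGen_succ, wS_apply_of_forall_ne]
    · intro t j hj
      rw [LinearMap.comp_apply, hd.map_w_even t hj, LinearMap.smul_apply, LinearMap.sum_apply,
        Finset.sum_congr rfl fun s _ => wCoord_wS s t _ _ (by omega) (by omega)]
      have : 1 ≠ 2 * (j + 1) := by omega
      simp [this]
  rw [h0, Finset.sum_eq_zero fun s _ => hx s 0, mul_zero]

lemma evenGen_mem (hd : IsStaircaseDifferential k p d) {N : Submodule S2 (AB (2 * k) → S2)}
    (hN : LinearMap.range d ≤ N) (hz : Pi.single AB.z0 1 ∈ N) (s : Fin 2) {i : ℕ} (hi : i ≤ k) :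
    evenGen (2 * k) s i ∈ N := by
  induction i with
  | zero => rwa [evenGen_zero]
  | succ i ih =>
    have h := hN (LinearMap.mem_range_self d (wS (2 * k) s (2 * i + 1)))
    rw [hd.map_odd s i hi] at h
    exact (N.add_mem_iff_right (N.smul_mem _ (ih (by omega)))).1 h

lemma mem_of_mem_ker (hd : IsStaircaseDifferential k p d) {N : Submodule S2 (AB (2 * k) → S2)}
    (hN : LinearMap.range d ≤ N) (hz : Pi.single AB.z0 1 ∈ N) (he : Pi.single AB.e 1 ∈ N)
    {x : AB (2 * k) → S2} (hx : d x = 0) : x ∈ N := by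
  have hodd := hd.wCoord_odd_eq_zero (x := x) (by simp [hx])
  have hxa : x AB.a = 0 := by rw [← hd.apply_b x, hx, Pi.zero_apply]
  have hxc : x AB.b = x AB.c := by
    have h := hd.apply_e x
    rw [hx, Pi.zero_apply, eq_comm, mul_eq_zero_iff_left X_ne_zero] at h
    exact CharTwo.add_eq_zero.1 h
  have hbc : (Pi.single AB.b 1 + Pi.single AB.c 1 : AB (2 * k) → S2) ∈ N :=
    hN ⟨_, hd.map_a⟩
  have hsub : x - x AB.b • (Pi.single AB.b 1 + Pi.single AB.c 1 : AB (2 * k) → S2) ∈ N := by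
    refine mem_of_forall_smul_mem ?_ ?_ ?_ ?_ ?_ ?_ ?_
    · simp [hxa]
    · simp
    · simp [hxc]
    · exact N.smul_mem _ he
    · exact N.smul_mem _ hz
    · intro s i hi
      have h : x (AB.w s ⟨2 * i, by omega⟩) = 0 :=
        (apply_w_eq_wCoord s _ x).trans (hodd s i)
      simp [h]
    · intro s i hi
      rw [← evenGen_succ]
      exact N.smul_mem _ (hd.evenGen_mem hN hz s hi)
  exact (N.sub_mem_iff_left (N.smul_mem _ hbc)).1 hsub

lemma exists_add_mem_range (hd : IsStaircaseDifferential k p d) {x : AB (2 * k) → S2}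
    (hx : d x = 0) : ∃ c₁ c₂ : S2,
      x + c₁ • (Pi.single AB.z0 1 : AB (2 * k) → S2) +
        c₂ • (Pi.single AB.e 1 : AB (2 * k) → S2) ∈ LinearMap.range d := by
  have h : x ∈ LinearMap.range d ⊔ Submodule.span S2 {Pi.single AB.z0 1, Pi.single AB.e 1} :=
    hd.mem_of_mem_ker le_sup_left
      (Submodule.mem_sup_right (Submodule.subset_span (by simp)))
      (Submodule.mem_sup_right (Submodule.subset_span (by simp))) hx
  obtain ⟨y, hy, w, hw, rfl⟩ := Submodule.mem_sup.1 h
  obtain ⟨c₁, c₂, rfl⟩ := Submodule.mem_span_pair.1 hw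
  refine ⟨-c₁, -c₂, ?_⟩
  convert hy using 1
  module

lemma smul_add_smul_mem_range_iff (hd : IsStaircaseDifferential k p d) (c₁ c₂ : S2) :
    c₁ • (Pi.single AB.z0 1 : AB (2 * k) → S2) + c₂ • (Pi.single AB.e 1 : AB (2 * k) → S2) ∈
      LinearMap.range d ↔ c₁ = 0 ∧ X ∣ c₂ := by
  constructor
  · rintro ⟨y, hy⟩
    have hodd := hd.wCoord_odd_eq_zero (x := y) (by simp [hy, wCoord_single])
    have hz := hd.apply_z0 hodd
    have he := hd.apply_e y
    rw [hy] at hz he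
    exact ⟨by simpa using hz, Dvd.intro _ (by simpa using he.symm)⟩
  · rintro ⟨rfl, q, rfl⟩
    exact ⟨q • Pi.single AB.b 1, by rw [map_smul, hd.map_b]; module⟩

end IsStaircaseDifferential

/-- Let `A` be the free `F₂[U]`-module on `{a, b, c, e, z_0} ∪ {w_r^s : 1 ≤ r ≤ v, s ∈ {1,2}}`
(`v = 2k`, `k ≥ 2`) with differential `∂a = b + c`, `∂b = ∂c = U • e`,
`∂w_1^s = U • z_0 + w_2^s`, `∂w_r^s = U • w_{r-1}^s + w_{r+1}^s` for odd `r` with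
`3 ≤ r ≤ v - 3`, `∂w_{v-1}^s = U² • w_{v-2}^s + w_v^s`, and `∂ = 0` on `e`, `z_0` and on
`w_r^s` for even `r`. Then `∂ ∘ ∂ = 0` and the homology `ker ∂ / range ∂` is isomorphic as
an `F₂[U]`-module to `F₂[U] ⊕ F₂[U]/(U)`, the free summand generated by the class of `z_0`
and the torsion summand by the class of `e`. -/
theorem modelC1dual_Aminus_homology (k : ℕ) (hk : 2 ≤ k) (v : ℕ) (hv : v = 2 * k)
    (d : (AB v → S2) →ₗ[S2] (AB v → S2))
    (hda : d (Pi.single AB.a 1) = Pi.single AB.b 1 + Pi.single AB.c 1)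
    (hdb : d (Pi.single AB.b 1) = (Polynomial.X : S2) • (Pi.single AB.e 1 : AB v → S2))
    (hdc : d (Pi.single AB.c 1) = (Polynomial.X : S2) • (Pi.single AB.e 1 : AB v → S2))
    (hdw1 : ∀ s : Fin 2, d (wS v s 1) =
      (Polynomial.X : S2) • (Pi.single AB.z0 1 : AB v → S2) + wS v s 2)
    (hdwodd : ∀ s : Fin 2, ∀ r : ℕ, 3 ≤ r → r ≤ v - 3 → Odd r →
      d (wS v s r) = (Polynomial.X : S2) • wS v s (r - 1) + wS v s (r + 1))
    (hdwv1 : ∀ s : Fin 2, d (wS v s (v - 1)) =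
      ((Polynomial.X : S2) ^ 2) • wS v s (v - 2) + wS v s v)
    (hde : d (Pi.single AB.e 1) = 0)
    (hdz0 : d (Pi.single AB.z0 1) = 0)
    (hdweven : ∀ s : Fin 2, ∀ r : ℕ, 1 ≤ r → r ≤ v → Even r → d (wS v s r) = 0) :
    d ∘ₗ d = 0 ∧
    (Pi.single AB.z0 1 : AB v → S2) ∈ LinearMap.ker d ∧
    (Pi.single AB.e 1 : AB v → S2) ∈ LinearMap.ker d ∧
    (∀ x ∈ LinearMap.ker d, ∃ c₁ c₂ : S2,
      x + c₁ • (Pi.single AB.z0 1 : AB v → S2) + c₂ • (Pi.single AB.e 1 : AB v → S2) ∈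
        LinearMap.range d) ∧
    (∀ c₁ c₂ : S2,
      (c₁ • (Pi.single AB.z0 1 : AB v → S2) + c₂ • (Pi.single AB.e 1 : AB v → S2) ∈
        LinearMap.range d) ↔ (c₁ = 0 ∧ (Polynomial.X : S2) ∣ c₂)) := by
  subst hv
  have hd : IsStaircaseDifferential k (fun i => if i + 1 = k then X ^ 2 else X) d := by
    refine ⟨hda, hdb, hdc, hde, fun s i hi => ?_, fun s i hi => ?_⟩
    · rcases i with _ | i
      · have : 1 ≠ k := by omega
        simpa [evenGen_zero, evenGen_succ, this] using hdw1 s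
      · simp only [evenGen_succ]
        by_cases h : i + 1 + 1 = k
        · subst h
          rw [if_pos rfl]
          exact hdwv1 s
        · rw [if_neg h]
          exact hdwodd s (2 * (i + 1) + 1) (by omega) (by omega) (odd_two_mul_add_one _)
    · rcases i with _ | i
      · rw [evenGen_zero, hdz0]
      · rw [evenGen_succ]
        exact hdweven s _ (by omega) (by omega) (even_two_mul _)
  exact ⟨hd.comp_self, hdz0, hde, fun x hx => hd.exists_add_mem_range hx,
    hd.smul_add_smul_mem_range_iff⟩
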